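/- arXiv:nlin/0603028 — 2 statements merged into one kernel-verified Lean document; each statement's English description precedes it below -/
import Mathlib

section
/- The monodromy entries D_n and B_n satisfy the exchange relation: for all λ, μ ∈ ℂ, (λ − ωμ)·D_n(μ)B_n(λ) = ω(λ − μ)·B_n(λ)D_n(μ) + λ(1 − ω)·D_n(λ)B_n(μ) as operators on V^(n). -/
open scoped BigOperators

noncomputable section

/-- The `n`-site quantum space of the Baxter–Bazhanov–Stroganov model:
functions `(Fin n → ZMod N) → ℂ`. -/
abbrev BBSV (N n : ℕ) : Type := (Fin n → ZMod N) → ℂ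

/-- Weyl operator `u_k`, acting diagonally by `ω^{γ_k}` on the basis vector `|γ⟩`. -/
def Uop (N : ℕ) (ω : ℂ) {n : ℕ} (k : Fin n) : Module.End ℂ (BBSV N n) where
  toFun f := fun γ => ω ^ (γ k).val * f γ
  map_add' f g := by funext γ; simp [mul_add]
  map_smul' r f := by
    funext γ
    simp only [Pi.smul_apply, smul_eq_mul, RingHom.id_apply]
    ring

/-- Weyl operator `u_k⁻¹`, acting diagonally by `ω^{-γ_k}` on the basis vector `|γ⟩`. -/
def Uinv (N : ℕ) (ω : ℂ) {n : ℕ} (k : Fin n) : Module.End ℂ (BBSV N n) where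
  toFun f := fun γ => ω ^ (-(γ k)).val * f γ
  map_add' f g := by funext γ; simp [mul_add]
  map_smul' r f := by
    funext γ
    simp only [Pi.smul_apply, smul_eq_mul, RingHom.id_apply]
    ring

/-- Weyl operator `v_k`, mapping `|γ⟩` to `|γ + e_k⟩`. -/
def Vop (N : ℕ) {n : ℕ} (k : Fin n) : Module.End ℂ (BBSV N n) where
  toFun f := fun γ => f (fun j => γ j - if j = k then 1 else 0)
  map_add' f g := rfl
  map_smul' r f := rfl

/-- The cyclic L-operator at site `k` with parameters `A B C D K`, a `2×2` matrix over
`End(V^(n))`. -/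
def Lop (N : ℕ) (ω : ℂ) {n : ℕ} (A B C D K : ℂ) (k : Fin n) (lam : ℂ) :
    Matrix (Fin 2) (Fin 2) (Module.End ℂ (BBSV N n)) :=
  !![1 + (lam * K) • Vop N k,
     lam • (Uinv N ω k * (A • (1 : Module.End ℂ (BBSV N n)) - B • Vop N k));
     Uop N ω k * (C • (1 : Module.End ℂ (BBSV N n)) - D • Vop N k),
     (lam * A * C) • (1 : Module.End ℂ (BBSV N n)) + (B * D / K) • Vop N k]

/-- The monodromy matrix `T_n(λ) = L_1(λ) ⋯ L_n(λ)` (sites `1,…,n` are indexed by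
`0,…,n-1`, the parameters being functions on `ℕ`). -/
def Tmat (N : ℕ) (ω : ℂ) (a b c d κ : ℕ → ℂ) (n : ℕ) (lam : ℂ) :
    Matrix (Fin 2) (Fin 2) (Module.End ℂ (BBSV N n)) :=
  ((List.finRange n).map
    (fun k => Lop N ω (a k.val) (b k.val) (c k.val) (d k.val) (κ k.val) k lam)).prod


/-! ### Kronecker products with commuting entries -/

open scoped Kronecker

section Kronecker

variable {m A : Type*} [Ring A]

/-- Every entry of `X` commutes with every entry of `Y`. -/
def EntriesCommute (X Y : Matrix m m A) : Prop :=
  ∀ i j k l, Commute (X i j) (Y k l)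

/-- The Kronecker product in which the entries of the second factor are multiplied from
the left. -/
def revKronecker (X Y : Matrix m m A) : Matrix (m × m) (m × m) A :=
  Matrix.kroneckerMap (fun x y => y * x) X Y

lemma EntriesCommute.symm {X Y : Matrix m m A} (h : EntriesCommute X Y) :
    EntriesCommute Y X :=
  fun i j k l => (h k l i j).symm

lemma EntriesCommute.one_right [DecidableEq m] (X : Matrix m m A) : EntriesCommute X 1 := by
  intro i j k l
  rw [Matrix.one_apply]
  split_ifs
  · exact Commute.one_right _
  · exact Commute.zero_right _

variable [Fintype m]

lemma EntriesCommute.mul_right {X Y Z : Matrix m m A}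
    (hY : EntriesCommute X Y) (hZ : EntriesCommute X Z) : EntriesCommute X (Y * Z) := by
  intro i j k l
  rw [Matrix.mul_apply]
  exact Commute.sum_right _ _ _ fun p _ => (hY i j k p).mul_right (hZ i j p l)

lemma mul_kronecker_mul_of_entriesCommute {X X' Y Y' : Matrix m m A}
    (h : EntriesCommute X' Y) : (X * X') ⊗ₖ (Y * Y') = X ⊗ₖ Y * X' ⊗ₖ Y' := by
  ext ⟨i, j⟩ ⟨p, q⟩
  simp only [Matrix.kronecker_apply, Matrix.mul_apply, Fintype.sum_prod_type,
    Finset.sum_mul_sum]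
  refine Finset.sum_congr rfl fun k _ => Finset.sum_congr rfl fun l _ => ?_
  rw [mul_assoc, ← mul_assoc (X' k p), (h k p j l).eq]
  simp only [mul_assoc]

lemma revKronecker_mul_of_entriesCommute {X X' Y Y' : Matrix m m A}
    (h : EntriesCommute X Y') :
    revKronecker (X * X') (Y * Y') = revKronecker X Y * revKronecker X' Y' := by
  ext ⟨i, j⟩ ⟨p, q⟩
  simp only [revKronecker, Matrix.kroneckerMap_apply, Matrix.mul_apply,
    Fintype.sum_prod_type, Finset.sum_mul_sum]
  rw [Finset.sum_comm]
  refine Finset.sum_congr rfl fun k _ => Finset.sum_congr rfl fun l _ => ?_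
  rw [mul_assoc, ← mul_assoc (Y' l q), ← (h i k l q).eq]
  simp only [mul_assoc]

variable [DecidableEq m]

lemma EntriesCommute.list_prod_right {ι : Type*} {X : Matrix m m A} {F : ι → Matrix m m A}
    {s : List ι} (h : ∀ k ∈ s, EntriesCommute X (F k)) :
    EntriesCommute X (s.map F).prod := by
  induction s with
  | nil => simpa using EntriesCommute.one_right X
  | cons k s ih =>
    rw [List.map_cons, List.prod_cons]
    exact (h k (by simp)).mul_right (ih fun j hj => h j (by simp [hj]))

/-- If each pair `F k`, `G k` is intertwined by `R`, and `F j`, `G k` have commuting entries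
for `j ≠ k`, then so is the pair of ordered products. -/
lemma intertwine_list_prod {ι : Type*} (R : Matrix (m × m) (m × m) A)
    (F G : ι → Matrix m m A)
    (hR : ∀ k, R * F k ⊗ₖ G k = revKronecker (F k) (G k) * R)
    (hFG : ∀ j k, j ≠ k → EntriesCommute (F j) (G k)) {s : List ι} (hs : s.Nodup) :
    R * (s.map F).prod ⊗ₖ (s.map G).prod =
      revKronecker (s.map F).prod (s.map G).prod * R := by
  induction s with
  | nil =>
    have h : revKronecker (1 : Matrix m m A) 1 = 1 := by
      rw [revKronecker, Matrix.kroneckerMap_one_one] <;> simp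
    simp [h]
  | cons k s ih =>
    obtain ⟨hk, hs⟩ := List.nodup_cons.1 hs
    have hne : ∀ j ∈ s, j ≠ k := fun j hj h => hk (h ▸ hj)
    simp only [List.map_cons, List.prod_cons]
    rw [mul_kronecker_mul_of_entriesCommute, revKronecker_mul_of_entriesCommute,
      ← mul_assoc, hR, mul_assoc, ih hs, mul_assoc]
    · exact .list_prod_right fun j hj => hFG k j (hne j hj).symm
    · exact (EntriesCommute.list_prod_right fun j hj => (hFG j k (hne j hj)).symm).symm

end Kronecker

/-! ### The intertwining relation for a single site -/

/-- The twisted six-vertex R-matrix. -/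
def sixVertex (ω lam mu : ℂ) : Matrix (Fin 2 × Fin 2) (Fin 2 × Fin 2) ℂ :=
  fun x y =>
    !![!![lam - ω * mu, 0; 0, 0], !![0, ω * (lam - mu); lam * (1 - ω), 0];
      !![0, mu * (1 - ω); lam - mu, 0], !![0, 0; 0, lam - ω * mu]] x.1 x.2 y.1 y.2

/-- The L-operator built from abstract elements `u`, `u'`, `v` of an algebra. -/
def weylL {A : Type*} [Ring A] [Algebra ℂ A] (u u' v : A) (a b c d κ lam : ℂ) :
    Matrix (Fin 2) (Fin 2) A :=
  !![1 + (lam * κ) • v, lam • (u' * (a • (1 : A) - b • v));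
    u * (c • (1 : A) - d • v), (lam * a * c) • (1 : A) + (b * d / κ) • v]

lemma commute_weylL {A : Type*} [Ring A] [Algebra ℂ A] {x u u' v : A}
    (hu : Commute x u) (hu' : Commute x u') (hv : Commute x v) (a b c d κ lam : ℂ)
    (i j : Fin 2) : Commute x (weylL u u' v a b c d κ lam i j) := by
  have h1 : Commute x 1 := Commute.one_right x
  fin_cases i <;> fin_cases j
  · exact h1.add_right (hv.smul_right _)
  · exact (hu'.mul_right ((h1.smul_right _).sub_right (hv.smul_right _))).smul_right _
  · exact hu.mul_right ((h1.smul_right _).sub_right (hv.smul_right _))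
  · exact (h1.smul_right _).add_right (hv.smul_right _)

lemma entriesCommute_weylL {A : Type*} [Ring A] [Algebra ℂ A] {u u' v w w' z : A}
    (huw : Commute u w) (huw' : Commute u w') (huz : Commute u z)
    (hu'w : Commute u' w) (hu'w' : Commute u' w') (hu'z : Commute u' z)
    (hvw : Commute v w) (hvw' : Commute v w') (hvz : Commute v z)
    (a b c d κ lam a' b' c' d' κ' mu : ℂ) :
    EntriesCommute (weylL u u' v a b c d κ lam) (weylL w w' z a' b' c' d' κ' mu) :=
  fun i j k l => (commute_weylL
    (commute_weylL huw huw' huz _ _ _ _ _ _ k l).symm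
    (commute_weylL hu'w hu'w' hu'z _ _ _ _ _ _ k l).symm
    (commute_weylL hvw hvw' hvz _ _ _ _ _ _ k l).symm _ _ _ _ _ _ i j).symm

set_option maxHeartbeats 1600000 in
lemma sixVertex_intertwine_weylL {A : Type*} [Ring A] [Algebra ℂ A] {ω : ℂ} (hω : ω ≠ 0)
    {u u' v : A} (huu' : u * u' = 1) (hu'u : u' * u = 1)
    (hvu : v * u = ω⁻¹ • (u * v)) (hvu' : v * u' = ω • (u' * v))
    (a b c d : ℂ) {κ : ℂ} (hκ : κ ≠ 0) (lam mu : ℂ) :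
    (sixVertex ω lam mu).map (algebraMap ℂ A) *
        weylL u u' v a b c d κ lam ⊗ₖ weylL u u' v a b c d κ mu =
      revKronecker (weylL u u' v a b c d κ lam) (weylL u u' v a b c d κ mu) *
        (sixVertex ω lam mu).map (algebraMap ℂ A) := by
  have hvuz (z : A) : v * (u * z) = ω⁻¹ • (u * (v * z)) := by
    rw [← mul_assoc, hvu, smul_mul_assoc, mul_assoc]
  have hvuz' (z : A) : v * (u' * z) = ω • (u' * (v * z)) := by
    rw [← mul_assoc, hvu', smul_mul_assoc, mul_assoc]
  have huz (z : A) : u * (u' * z) = z := by rw [← mul_assoc, huu', one_mul]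
  have huz' (z : A) : u' * (u * z) = z := by rw [← mul_assoc, hu'u, one_mul]
  ext ⟨i, j⟩ ⟨p, q⟩
  simp only [Matrix.mul_apply, Fintype.sum_prod_type, Fin.sum_univ_two, Matrix.map_apply,
    revKronecker, Matrix.kroneckerMap_apply, ← Algebra.smul_def,
    ← Algebra.commutes]
  fin_cases i <;> fin_cases j <;> fin_cases p <;> fin_cases q <;>
  simp [sixVertex, weylL, mul_add, add_mul, mul_sub, sub_mul, mul_assoc, hvuz, hvuz', huz, huz', huu', hu'u, hvu, hvu',
    -mul_eq_mul_left_iff, -mul_eq_mul_right_iff] <;>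
  match_scalars <;> field_simp <;> ring

/-! ### The Weyl operators -/

section Weyl

variable {N : ℕ} {ω : ℂ} {n : ℕ}

lemma pow_val_add [NeZero N] (h : ω ^ N = 1) (x y : ZMod N) :
    ω ^ (x + y).val = ω ^ x.val * ω ^ y.val := by
  rw [ZMod.val_add, ← pow_add, ← pow_eq_pow_mod _ h]

lemma pow_val_mul_pow_val_neg [NeZero N] (h : ω ^ N = 1) (x : ZMod N) :
    ω ^ x.val * ω ^ (-x).val = 1 := by
  rw [← pow_val_add h, add_neg_cancel, ZMod.val_zero, pow_zero]

lemma Uop_mul_Uinv [NeZero N] (h : ω ^ N = 1) (k : Fin n) :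
    Uop N ω k * Uinv N ω k = 1 := by
  refine LinearMap.ext fun f => funext fun γ => ?_
  change ω ^ (γ k).val * (ω ^ (-(γ k)).val * f γ) = f γ
  rw [← mul_assoc, pow_val_mul_pow_val_neg h, one_mul]

lemma Uinv_mul_Uop [NeZero N] (h : ω ^ N = 1) (k : Fin n) :
    Uinv N ω k * Uop N ω k = 1 := by
  refine LinearMap.ext fun f => funext fun γ => ?_
  change ω ^ (-(γ k)).val * (ω ^ (γ k).val * f γ) = f γ
  rw [mul_left_comm, ← mul_assoc, pow_val_mul_pow_val_neg h, one_mul]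

lemma Vop_mul_Uinv [Fact (1 < N)] [NeZero N] (h : ω ^ N = 1) (k : Fin n) :
    Vop N k * Uinv N ω k = ω • (Uinv N ω k * Vop N k) := by
  refine LinearMap.ext fun f => funext fun γ => ?_
  change ω ^ (-(γ k - if k = k then 1 else 0)).val * Vop N k f γ =
    ω * (ω ^ (-(γ k)).val * Vop N k f γ)
  rw [if_pos rfl, neg_sub, sub_eq_add_neg, pow_val_add h, ZMod.val_one, pow_one, mul_assoc]

lemma Vop_mul_Uop [Fact (1 < N)] [NeZero N] (h : ω ^ N = 1) (hω : ω ≠ 0) (k : Fin n) :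
    Vop N k * Uop N ω k = ω⁻¹ • (Uop N ω k * Vop N k) := by
  rw [eq_inv_smul_iff₀ hω]
  refine LinearMap.ext fun f => funext fun γ => ?_
  change ω * (ω ^ (γ k - if k = k then 1 else 0).val * Vop N k f γ) =
    ω ^ (γ k).val * Vop N k f γ
  have h1 : ω ^ (γ k).val = ω ^ (γ k - 1).val * ω := by
    conv_lhs => rw [← sub_add_cancel (γ k) 1, pow_val_add h, ZMod.val_one, pow_one]
  rw [if_pos rfl, h1]
  ring

lemma commute_Uop_Uop (j k : Fin n) : Commute (Uop N ω j) (Uop N ω k) := by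
  refine LinearMap.ext fun f => funext fun γ => ?_
  exact mul_left_comm _ _ _

lemma commute_Uop_Uinv (j k : Fin n) : Commute (Uop N ω j) (Uinv N ω k) := by
  refine LinearMap.ext fun f => funext fun γ => ?_
  exact mul_left_comm _ _ _

lemma commute_Uinv_Uinv (j k : Fin n) : Commute (Uinv N ω j) (Uinv N ω k) := by
  refine LinearMap.ext fun f => funext fun γ => ?_
  exact mul_left_comm _ _ _

lemma commute_Vop_Vop (j k : Fin n) : Commute (Vop N j) (Vop N k) := by
  refine LinearMap.ext fun f => funext fun γ => ?_
  exact congrArg f (funext fun i => sub_right_comm _ _ _)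

lemma commute_Vop_Uop {j k : Fin n} (hjk : j ≠ k) : Commute (Vop N j) (Uop N ω k) := by
  refine LinearMap.ext fun f => funext fun γ => ?_
  change ω ^ (γ k - if k = j then 1 else 0).val * Vop N j f γ =
    ω ^ (γ k).val * Vop N j f γ
  rw [if_neg hjk.symm, sub_zero]

lemma commute_Vop_Uinv {j k : Fin n} (hjk : j ≠ k) : Commute (Vop N j) (Uinv N ω k) := by
  refine LinearMap.ext fun f => funext fun γ => ?_
  change ω ^ (-(γ k - if k = j then 1 else 0)).val * Vop N j f γ =
    ω ^ (-(γ k)).val * Vop N j f γ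
  rw [if_neg hjk.symm, sub_zero]

lemma entriesCommute_Lop {j k : Fin n} (hjk : j ≠ k)
    (a b c d κ lam a' b' c' d' κ' mu : ℂ) :
    EntriesCommute (Lop N ω a b c d κ j lam) (Lop N ω a' b' c' d' κ' k mu) :=
  entriesCommute_weylL (commute_Uop_Uop j k) (commute_Uop_Uinv j k)
    (commute_Vop_Uop hjk.symm).symm (commute_Uop_Uinv k j).symm (commute_Uinv_Uinv j k)
    (commute_Vop_Uinv hjk.symm).symm (commute_Vop_Uop hjk) (commute_Vop_Uinv hjk)
    (commute_Vop_Vop j k) _ _ _ _ _ _ _ _ _ _ _ _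

/-- The RTT relation for the monodromy matrix. -/
lemma sixVertex_intertwine_Tmat [Fact (1 < N)] [NeZero N] (h : ω ^ N = 1) (hω : ω ≠ 0)
    (a b c d κ : ℕ → ℂ) (hκ : ∀ k < n, κ k ≠ 0) (lam mu : ℂ) :
    (sixVertex ω lam mu).map (algebraMap ℂ (Module.End ℂ (BBSV N n))) *
        Tmat N ω a b c d κ n lam ⊗ₖ Tmat N ω a b c d κ n mu =
      revKronecker (Tmat N ω a b c d κ n lam) (Tmat N ω a b c d κ n mu) *
        (sixVertex ω lam mu).map (algebraMap ℂ (Module.End ℂ (BBSV N n))) :=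
  intertwine_list_prod _ _ _
    (fun k => sixVertex_intertwine_weylL hω (Uop_mul_Uinv h k) (Uinv_mul_Uop h k)
      (Vop_mul_Uop h hω k) (Vop_mul_Uinv h k) _ _ _ _ (hκ k k.isLt) lam mu)
    (fun _ _ hjk => entriesCommute_Lop hjk _ _ _ _ _ _ _ _ _ _ _ _)
    (List.nodup_finRange n)

end Weyl

/-- Exchange relation between the monodromy entries `D_n` and `B_n`:
`(λ − ωμ)·D_n(μ)B_n(λ) = ω(λ − μ)·B_n(λ)D_n(μ) + λ(1 − ω)·D_n(λ)B_n(μ)`. -/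
theorem bbs_DB_exchange
    (N : ℕ) (hN : 2 ≤ N) (n : ℕ) (hn : 1 ≤ n)
    (ω : ℂ) (hω : ω = Complex.exp (2 * Real.pi * Complex.I / N))
    (a b c d κ : ℕ → ℂ) (hκ : ∀ k < n, κ k ≠ 0)
    (lam mu : ℂ) :
    (lam - ω * mu) • (Tmat N ω a b c d κ n mu 1 1 * Tmat N ω a b c d κ n lam 0 1) =
      (ω * (lam - mu)) • (Tmat N ω a b c d κ n lam 0 1 * Tmat N ω a b c d κ n mu 1 1) +
        (lam * (1 - ω)) • (Tmat N ω a b c d κ n lam 1 1 * Tmat N ω a b c d κ n mu 0 1) := by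
  have : Fact (1 < N) := ⟨hN⟩
  have : NeZero N := ⟨by omega⟩
  have hω0 : ω ≠ 0 := hω ▸ Complex.exp_ne_zero _
  have h1 : ω ^ N = 1 := hω ▸ (Complex.isPrimitiveRoot_exp N (NeZero.ne N)).pow_eq_one
  have h := congrFun (congrFun (sixVertex_intertwine_Tmat h1 hω0 a b c d κ hκ lam mu)
    (0, 1)) (1, 1)
  simp only [Matrix.mul_apply, Fintype.sum_prod_type, Fin.sum_univ_two, Matrix.map_apply,
    revKronecker, Matrix.kroneckerMap_apply, ← Algebra.smul_def,
    ← Algebra.commutes] at h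
  simpa [sixVertex] using h.symm
end
end

section
/- Two-site eigenvectors of B₂: under the stated hypotheses, for every (ρ_{2,0}, ρ_{2,1}) ∈ (ZMod N)², the vector Ψ = Σ_{ρ₁, ρ₂ ∈ ZMod N} Q(ρ₁, ρ₂) ψ^{(1)}_{ρ₁} ⊗ ψ^{(2)}_{ρ₂} ∈ V^(2), where Q(ρ₁, ρ₂) = ω^{−(ρ_{2,0}+ρ_{2,1}−ρ₁)(ρ_{2,0}−ρ₂)} / ( w_{p_{2,0}}(ρ_{2,0} − ρ₁ − 1) · w_{p̃_2}(ρ_{2,0} + ρ_{2,1} − ρ₂ − 1) ), satisfies B₂(λ)Ψ = λ r_{2,0} ω^{−ρ_{2,0}} (λ + r_{2,1} ω^{−ρ_{2,1}}) Ψ for all λ ∈ ℂ. -/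
open scoped BigOperators

noncomputable section

/-- Auxiliary recursion for the cyclic function `w_p`:
`wrec 0 = 1`, `wrec (m+1) = wrec m · y/(1 − ω^{m+1} x)`. -/
def wrec (ω x y : ℂ) : ℕ → ℂ
  | 0 => 1
  | m + 1 => wrec ω x y m * (y / (1 - ω ^ (m + 1) * x))

/-- The cyclic function `w_p : ZMod N → ℂ` attached to a Fermat-curve point `p = (x, y)`,
determined by `w_p(0) = 1` and `w_p(γ)/w_p(γ−1) = y/(1 − ω^γ x)`. -/
def wfun (N : ℕ) (ω : ℂ) (p : ℂ × ℂ) (γ : ZMod N) : ℂ := wrec ω p.1 p.2 γ.val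

section PowVal

variable {N : ℕ} [NeZero N] {ω : ℂ}

theorem pow_val_add_s9 (hω : ω ^ N = 1) (m n : ZMod N) :
    ω ^ (m + n).val = ω ^ m.val * ω ^ n.val := by
  rw [ZMod.val_add, ← pow_eq_pow_mod _ hω, pow_add]

theorem pow_val_neg_mul_pow_val (hω : ω ^ N = 1) (m : ZMod N) :
    ω ^ (-m).val * ω ^ m.val = 1 := by
  rw [← pow_val_add_s9 hω]
  simp

theorem pow_val_sub (hω : ω ^ N = 1) (m n : ZMod N) :
    ω ^ (m - n).val = ω ^ m.val * ω ^ (-n).val := by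
  rw [sub_eq_add_neg, pow_val_add_s9 hω]

end PowVal

section CyclicFunction

variable {N : ℕ} {ω x y : ℂ}

theorem one_sub_pow_eq_prod (hω : IsPrimitiveRoot ω N) (hN : 0 < N) (x : ℂ) :
    1 - x ^ N = ∏ i ∈ Finset.range N, (1 - ω ^ i * x) := by
  have h := congrArg (Polynomial.eval 1) (X_pow_sub_C_eq_prod (α := x) hω hN rfl)
  simpa [Polynomial.eval_prod] using h

theorem one_sub_pow_mul_ne_zero (hω : ω ^ N = 1) (hx : x ^ N ≠ 1) (m : ℕ) :
    1 - ω ^ m * x ≠ 0 := by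
  intro h
  apply hx
  have h' := congrArg (· ^ N) (sub_eq_zero.mp h)
  simp only [one_pow, mul_pow, ← pow_mul, mul_comm m N] at h'
  rw [pow_mul, hω, one_pow, one_mul] at h'
  exact h'.symm

theorem wrec_mul_prod (h : ∀ m : ℕ, 1 - ω ^ m * x ≠ 0) (m : ℕ) :
    wrec ω x y m * ∏ i ∈ Finset.range m, (1 - ω ^ (i + 1) * x) = y ^ m := by
  induction m with
  | zero => simp [wrec]
  | succ m ih =>
    rw [Finset.prod_range_succ, wrec]
    linear_combination y * ih + wrec ω x y m * (∏ i ∈ Finset.range m, (1 - ω ^ (i + 1) * x)) *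
      div_mul_cancel₀ y (h (m + 1))

theorem wrec_card (hω : IsPrimitiveRoot ω N) (hN : 0 < N)
    (hxy : x ^ N + y ^ N = 1) (hx : x ^ N ≠ 1) : wrec ω x y N = 1 := by
  have h := one_sub_pow_mul_ne_zero hω.pow_eq_one hx
  have hprod : ∏ i ∈ Finset.range N, (1 - ω ^ (i + 1) * x) = 1 - x ^ N := by
    rw [one_sub_pow_eq_prod hω hN]
    apply mul_right_cancel₀ (h 0)
    rw [← Finset.prod_range_succ' (fun i => 1 - ω ^ i * x), Finset.prod_range_succ,
      hω.pow_eq_one, pow_zero]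
  have hw := wrec_mul_prod (y := y) h N
  rw [hprod, eq_sub_of_add_eq' hxy] at hw
  exact mul_right_cancel₀ (sub_ne_zero.mpr hx.symm) (hw.trans (one_mul _).symm)

theorem wfun_ne_zero (hω : ω ^ N = 1) (hy : y ≠ 0) (hx : x ^ N ≠ 1) (γ : ZMod N) :
    wfun N ω (x, y) γ ≠ 0 := fun h0 => by
  have h := wrec_mul_prod (y := y) (one_sub_pow_mul_ne_zero hω hx) γ.val
  rw [show wrec ω x y γ.val = 0 from h0, zero_mul] at h
  exact pow_ne_zero _ hy h.symm

variable [NeZero N]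

theorem wfun_mul_one_sub (hω : IsPrimitiveRoot ω N)
    (hxy : x ^ N + y ^ N = 1) (hx : x ^ N ≠ 1) (γ : ZMod N) :
    wfun N ω (x, y) γ * (1 - ω ^ γ.val * x) = y * wfun N ω (x, y) (γ - 1) := by
  have hN : 0 < N := Nat.pos_of_ne_zero (NeZero.ne N)
  have h := one_sub_pow_mul_ne_zero hω.pow_eq_one hx
  obtain ⟨g, rfl⟩ : ∃ g, γ = g + 1 := ⟨γ - 1, by ring⟩
  have key : wfun N ω (x, y) (g + 1) = wrec ω x y (g.val + 1) ∧
      ω ^ (g + 1).val = ω ^ (g.val + 1) := by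
    have hcast : ((g.val + 1 : ℕ) : ZMod N) = g + 1 := by simp
    rw [wfun, ← hcast, ZMod.val_natCast]
    refine ⟨?_, (pow_eq_pow_mod _ hω.pow_eq_one).symm⟩
    rcases (Nat.succ_le_of_lt (ZMod.val_lt g)).lt_or_eq with hlt | heq
    · rw [Nat.mod_eq_of_lt hlt]
    · rw [← Nat.succ_eq_add_one, heq, Nat.mod_self, wrec_card hω hN hxy hx, wrec]
  rw [key.1, key.2, add_sub_cancel_right, wfun, wrec]
  field_simp [h (g.val + 1)]

/-- The one-site vectors are eigenvectors of `u⁻¹ (a - b v)`. -/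
theorem wfun_eigen (hω : IsPrimitiveRoot ω N) {a b : ℂ} (ha : a ≠ 0)
    (hxy : x ^ N = 1 - (b / a) ^ N) (hx : x ^ N ≠ 1) (γ ρ : ZMod N) :
    ω ^ (-γ).val * (a * wfun N ω (x, b / a) (γ - ρ) - b * wfun N ω (x, b / a) (γ - 1 - ρ)) =
      a * x * ω ^ (-ρ).val * wfun N ω (x, b / a) (γ - ρ) := by
  have hrec := wfun_mul_one_sub hω (eq_sub_iff_add_eq.mp hxy) hx (γ - ρ)
  rw [show γ - ρ - 1 = γ - 1 - ρ by ring, div_mul_eq_mul_div, eq_div_iff ha,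
    pow_val_sub hω.pow_eq_one] at hrec
  linear_combination ω ^ (-γ).val * hrec + a * x * ω ^ (-ρ).val * wfun N ω (x, b / a) (γ - ρ) *
    pow_val_neg_mul_pow_val hω.pow_eq_one γ

end CyclicFunction

section TwoSite

variable {N : ℕ} [NeZero N] {ω : ℂ}

/-- The vector `∑ q(ρ₁, ρ₂) f(· - ρ₁) ⊗ g(· - ρ₂)` on two sites. -/
def shiftSum (f g : ZMod N → ℂ) (q : ZMod N → ZMod N → ℂ) : BBSV N 2 :=
  fun γ => ∑ ρ1 : ZMod N, ∑ ρ2 : ZMod N, q ρ1 ρ2 * f (γ 0 - ρ1) * g (γ 1 - ρ2)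

variable (f g : ZMod N → ℂ) (q q' : ZMod N → ZMod N → ℂ)

theorem shiftSum_add : shiftSum f g q + shiftSum f g q' =
    shiftSum f g (fun ρ1 ρ2 => q ρ1 ρ2 + q' ρ1 ρ2) := by
  funext γ
  simp only [shiftSum, Pi.add_apply, add_mul, Finset.sum_add_distrib]

theorem smul_shiftSum (s : ℂ) :
    s • shiftSum f g q = shiftSum f g (fun ρ1 ρ2 => s * q ρ1 ρ2) := by
  funext γ
  simp only [shiftSum, Pi.smul_apply, smul_eq_mul, Finset.mul_sum, mul_assoc]

theorem Vop_zero_shiftSum :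
    Vop N 0 (shiftSum f g q) = shiftSum f g (fun ρ1 ρ2 => q (ρ1 - 1) ρ2) := by
  funext γ
  simp only [Vop, shiftSum, LinearMap.coe_mk, AddHom.coe_mk, if_true, one_ne_zero, if_false,
    sub_zero]
  refine Fintype.sum_equiv (Equiv.addRight 1) _ _ fun ρ1 => ?_
  simp [sub_sub, add_comm]

theorem Vop_one_shiftSum :
    Vop N 1 (shiftSum f g q) = shiftSum f g (fun ρ1 ρ2 => q ρ1 (ρ2 - 1)) := by
  funext γ
  simp only [Vop, shiftSum, LinearMap.coe_mk, AddHom.coe_mk, if_true, zero_ne_one, if_false,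
    sub_zero]
  refine Finset.sum_congr rfl fun ρ1 _ => ?_
  refine Fintype.sum_equiv (Equiv.addRight 1) _ _ fun ρ2 => ?_
  simp [sub_sub, add_comm]

theorem Uinv_mul_zero_shiftSum {A B r : ℂ}
    (hf : ∀ γ ρ : ZMod N, ω ^ (-γ).val * (A * f (γ - ρ) - B * f (γ - 1 - ρ)) =
      r * ω ^ (-ρ).val * f (γ - ρ)) :
    (Uinv N ω 0 * (A • 1 - B • Vop N 0) : Module.End ℂ (BBSV N 2)) (shiftSum f g q) =
      shiftSum f g (fun ρ1 ρ2 => r * ω ^ (-ρ1).val * q ρ1 ρ2) := by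
  funext γ
  simp only [Uinv, Vop, shiftSum, Module.End.mul_apply, LinearMap.sub_apply, LinearMap.smul_apply,
    Module.End.one_apply, LinearMap.coe_mk, AddHom.coe_mk, Pi.sub_apply, Pi.smul_apply,
    smul_eq_mul, if_true, one_ne_zero, if_false, sub_zero, Finset.mul_sum,
    ← Finset.sum_sub_distrib]
  refine Finset.sum_congr rfl fun ρ1 _ => Finset.sum_congr rfl fun ρ2 _ => ?_
  linear_combination q ρ1 ρ2 * g (γ 1 - ρ2) * hf (γ 0) ρ1

theorem Uinv_mul_one_shiftSum {A B r : ℂ}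
    (hg : ∀ γ ρ : ZMod N, ω ^ (-γ).val * (A * g (γ - ρ) - B * g (γ - 1 - ρ)) =
      r * ω ^ (-ρ).val * g (γ - ρ)) :
    (Uinv N ω 1 * (A • 1 - B • Vop N 1) : Module.End ℂ (BBSV N 2)) (shiftSum f g q) =
      shiftSum f g (fun ρ1 ρ2 => r * ω ^ (-ρ2).val * q ρ1 ρ2) := by
  funext γ
  simp only [Uinv, Vop, shiftSum, Module.End.mul_apply, LinearMap.sub_apply, LinearMap.smul_apply,
    Module.End.one_apply, LinearMap.coe_mk, AddHom.coe_mk, Pi.sub_apply, Pi.smul_apply,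
    smul_eq_mul, if_true, zero_ne_one, if_false, sub_zero, Finset.mul_sum,
    ← Finset.sum_sub_distrib]
  refine Finset.sum_congr rfl fun ρ1 _ => Finset.sum_congr rfl fun ρ2 _ => ?_
  linear_combination q ρ1 ρ2 * f (γ 0 - ρ1) * hg (γ 1) ρ2

end TwoSite

/-- Two-site eigenvectors of `B₂`: the vector
`Ψ = Σ_{ρ₁,ρ₂} Q(ρ₁,ρ₂) ψ^{(1)}_{ρ₁} ⊗ ψ^{(2)}_{ρ₂}` with
`Q(ρ₁,ρ₂) = ω^{−(ρ_{2,0}+ρ_{2,1}−ρ₁)(ρ_{2,0}−ρ₂)} /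
(w_{p_{2,0}}(ρ_{2,0}−ρ₁−1)·w_{p̃_2}(ρ_{2,0}+ρ_{2,1}−ρ₂−1))`
satisfies `B₂(λ)Ψ = λ r_{2,0} ω^{−ρ_{2,0}} (λ + r_{2,1} ω^{−ρ_{2,1}}) Ψ` for all `λ`. -/
theorem bbs_two_site_eigenvector
    (N : ℕ) [NeZero N] (hN : 2 ≤ N)
    (ω : ℂ) (hω : ω = Complex.exp (2 * Real.pi * Complex.I / N))
    (a b c d κ : ℕ → ℂ)
    (ha : ∀ k < 2, a k ≠ 0) (hκ : ∀ k < 2, κ k ≠ 0)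
    -- one-site Fermat data: p_k = (x_k, b_k/a_k), r_k = a_k x_k
    (x1 x2 : ℂ)
    (hx1 : x1 ^ N = 1 - (b 0 / a 0) ^ N) (hx1' : x1 ^ N ≠ 1)
    (hx2 : x2 ^ N = 1 - (b 1 / a 1) ^ N) (hx2' : x2 ^ N ≠ 1)
    -- amplitudes r_{2,0}, r_{2,1}
    (r20 r21 : ℂ) (hr20 : r20 ≠ 0) (hr21 : r21 ≠ 0)
    -- Fermat points p_{2,0} = (x20, y20) and p̃_2 = (xt2, yt2)
    (x20 y20 xt2 yt2 : ℂ)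
    (hx20 : x20 = a 1 * c 1 * (a 0 * x1) / r20)
    (hy20 : y20 = κ 0 * (a 1 * x2) / r20)
    (hxt2 : xt2 = (a 1 * x2) / (r20 * r21))
    (hyt2 : yt2 = b 1 * d 1 / κ 1 * (a 0 * x1) / (r20 * r21))
    (hp20 : x20 ^ N + y20 ^ N = 1) (hp20' : x20 ^ N ≠ 1)
    (hpt2 : xt2 ^ N + yt2 ^ N = 1) (hpt2' : xt2 ^ N ≠ 1)
    -- labels and the coefficient function Q
    (ρ20 ρ21 : ZMod N)
    (Q : ZMod N → ZMod N → ℂ)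
    (hQ : ∀ ρ1 ρ2, Q ρ1 ρ2 =
      ω ^ (-((ρ20 + ρ21 - ρ1) * (ρ20 - ρ2))).val /
        (wfun N ω (x20, y20) (ρ20 - ρ1 - 1) * wfun N ω (xt2, yt2) (ρ20 + ρ21 - ρ2 - 1)))
    -- the two-site vector Ψ = Σ Q(ρ₁,ρ₂) ψ^{(1)}_{ρ₁} ⊗ ψ^{(2)}_{ρ₂}
    (Ψ : BBSV N 2)
    (hΨ : Ψ = fun γ => ∑ ρ1 : ZMod N, ∑ ρ2 : ZMod N,
      Q ρ1 ρ2 * wfun N ω (x1, b 0 / a 0) (γ 0 - ρ1) * wfun N ω (x2, b 1 / a 1) (γ 1 - ρ2)) :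
    ∀ lam : ℂ,
      Tmat N ω a b c d κ 2 lam 0 1 Ψ =
        (lam * r20 * ω ^ (-ρ20).val * (lam + r21 * ω ^ (-ρ21).val)) • Ψ := by
  intro lam
  have hprim : IsPrimitiveRoot ω N := hω ▸ Complex.isPrimitiveRoot_exp N (NeZero.ne N)
  have hone := hprim.pow_eq_one
  have hb : ∀ {k : ℕ} {x : ℂ}, x ^ N = 1 - (b k / a k) ^ N → x ^ N ≠ 1 → b k / a k ≠ 0 := by
    intro k x h h' h0
    rw [h0, zero_pow (NeZero.ne N), sub_zero] at h
    exact h' h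
  have hy_ne : ∀ {x y : ℂ}, x ^ N + y ^ N = 1 → x ^ N ≠ 1 → y ≠ 0 := by
    rintro x y h h' rfl
    rw [zero_pow (NeZero.ne N), add_zero] at h
    exact h' h
  have hw20 := wfun_ne_zero hone (hy_ne hp20 hp20') hp20'
  have hwt2 := wfun_ne_zero hone (hy_ne hpt2 hpt2') hpt2'
  have hQ1 : ∀ ρ1 ρ2, y20 * ω ^ (-ρ2).val * Q (ρ1 - 1) ρ2 =
      (ω ^ (-ρ20).val - x20 * ω ^ (-ρ1).val) * Q ρ1 ρ2 := by
    intro ρ1 ρ2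
    have hrec := wfun_mul_one_sub hprim hp20 hp20' (ρ20 - ρ1)
    rw [pow_val_sub hone] at hrec
    have hinv := pow_val_neg_mul_pow_val hone ρ20
    have hphase : ω ^ (-ρ2).val * ω ^ (-((ρ20 + ρ21 - (ρ1 - 1)) * (ρ20 - ρ2))).val =
        ω ^ (-ρ20).val * ω ^ (-((ρ20 + ρ21 - ρ1) * (ρ20 - ρ2))).val := by
      rw [← pow_val_add_s9 hone, ← pow_val_add_s9 hone]
      congr 2
      ring
    rw [hQ, hQ, show ρ20 - (ρ1 - 1) - 1 = ρ20 - ρ1 by ring]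
    have h1 := hw20 (ρ20 - ρ1)
    have h2 := hw20 (ρ20 - ρ1 - 1)
    have h3 := hwt2 (ρ20 + ρ21 - ρ2 - 1)
    rw [← mul_div_assoc, ← mul_div_assoc, div_eq_div_iff (mul_ne_zero h1 h3) (mul_ne_zero h2 h3)]
    generalize ω ^ (-((ρ20 + ρ21 - (ρ1 - 1)) * (ρ20 - ρ2))).val = E' at *
    generalize ω ^ (-((ρ20 + ρ21 - ρ1) * (ρ20 - ρ2))).val = E at *
    generalize wfun N ω (xt2, yt2) (ρ20 + ρ21 - ρ2 - 1) = W at *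
    generalize wfun N ω (x20, y20) (ρ20 - ρ1) = w1 at *
    generalize wfun N ω (x20, y20) (ρ20 - ρ1 - 1) = w0 at *
    linear_combination y20 * w0 * W * hphase - ω ^ (-ρ20).val * E * W * hrec -
      x20 * ω ^ (-ρ1).val * E * w1 * W * hinv
  have hQ2 : ∀ ρ1 ρ2, yt2 * ω ^ (-ρ1).val * Q ρ1 (ρ2 - 1) =
      (ω ^ (-(ρ20 + ρ21)).val - xt2 * ω ^ (-ρ2).val) * Q ρ1 ρ2 := by
    intro ρ1 ρ2
    have hrec := wfun_mul_one_sub hprim hpt2 hpt2' (ρ20 + ρ21 - ρ2)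
    rw [pow_val_sub hone] at hrec
    have hinv := pow_val_neg_mul_pow_val hone (ρ20 + ρ21)
    have hphase : ω ^ (-ρ1).val * ω ^ (-((ρ20 + ρ21 - ρ1) * (ρ20 - (ρ2 - 1)))).val =
        ω ^ (-(ρ20 + ρ21)).val * ω ^ (-((ρ20 + ρ21 - ρ1) * (ρ20 - ρ2))).val := by
      rw [← pow_val_add_s9 hone, ← pow_val_add_s9 hone]
      congr 2
      ring
    rw [hQ, hQ, show ρ20 + ρ21 - (ρ2 - 1) - 1 = ρ20 + ρ21 - ρ2 by ring]
    have h1 := hwt2 (ρ20 + ρ21 - ρ2)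
    have h2 := hwt2 (ρ20 + ρ21 - ρ2 - 1)
    have h3 := hw20 (ρ20 - ρ1 - 1)
    rw [← mul_div_assoc, ← mul_div_assoc, div_eq_div_iff (mul_ne_zero h3 h1) (mul_ne_zero h3 h2)]
    generalize ω ^ (-((ρ20 + ρ21 - ρ1) * (ρ20 - (ρ2 - 1)))).val = E' at *
    generalize ω ^ (-((ρ20 + ρ21 - ρ1) * (ρ20 - ρ2))).val = E at *
    generalize wfun N ω (x20, y20) (ρ20 - ρ1 - 1) = W at *
    generalize wfun N ω (xt2, yt2) (ρ20 + ρ21 - ρ2) = w1 at *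
    generalize wfun N ω (xt2, yt2) (ρ20 + ρ21 - ρ2 - 1) = w0 at *
    linear_combination yt2 * w0 * W * hphase - ω ^ (-(ρ20 + ρ21)).val * E * W * hrec -
      xt2 * ω ^ (-ρ2).val * E * w1 * W * hinv
  have hΨ' : Ψ = shiftSum (wfun N ω (x1, b 0 / a 0)) (wfun N ω (x2, b 1 / a 1)) Q := hΨ
  have hB : Tmat N ω a b c d κ 2 lam 0 1 =
      (1 + (lam * κ 0) • Vop N 0) *
        (lam • (Uinv N ω 1 * (a 1 • (1 : Module.End ℂ (BBSV N 2)) - b 1 • Vop N 1))) +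
      (lam • (Uinv N ω 0 * (a 0 • (1 : Module.End ℂ (BBSV N 2)) - b 0 • Vop N 0))) *
        ((lam * a 1 * c 1) • (1 : Module.End ℂ (BBSV N 2)) + (b 1 * d 1 / κ 1) • Vop N 1) := by
    simp [Tmat, Lop, List.finRange_succ, Matrix.mul_apply, Fin.sum_univ_two]
  have hE0 := wfun_eigen hprim (ha 0 (by norm_num)) hx1 hx1'
  have hE1 := wfun_eigen hprim (ha 1 (by norm_num)) hx2 hx2'
  rw [hB, hΨ', LinearMap.add_apply, Module.End.mul_apply, Module.End.mul_apply,
    LinearMap.smul_apply, LinearMap.smul_apply, Uinv_mul_one_shiftSum _ _ _ hE1]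
  simp only [LinearMap.add_apply, LinearMap.smul_apply, Module.End.one_apply, smul_shiftSum,
    Vop_zero_shiftSum, Vop_one_shiftSum, shiftSum_add]
  rw [Uinv_mul_zero_shiftSum _ _ _ hE0]
  simp only [smul_shiftSum, shiftSum_add]
  congr 1
  funext ρ1 ρ2
  have h1 := hQ1 ρ1 ρ2
  have h2 := hQ2 ρ1 ρ2
  rw [neg_add, pow_val_add_s9 hone] at h2
  have e1 : r20 * x20 = a 1 * c 1 * (a 0 * x1) := by rw [hx20]; field_simp
  have e2 : r20 * y20 = κ 0 * (a 1 * x2) := by rw [hy20]; field_simp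
  have e3 : r20 * r21 * xt2 = a 1 * x2 := by rw [hxt2]; field_simp
  have e4 : r20 * r21 * yt2 = b 1 * d 1 / κ 1 * (a 0 * x1) := by
    rw [hyt2]; field_simp
  generalize b 1 * d 1 / κ 1 = β at *
  linear_combination lam ^ 2 * r20 * h1 + lam * r20 * r21 * h2 -
    lam ^ 2 * ω ^ (-ρ1).val * Q ρ1 ρ2 * e1 - lam ^ 2 * ω ^ (-ρ2).val * Q (ρ1 - 1) ρ2 * e2 -
    lam * ω ^ (-ρ2).val * Q ρ1 ρ2 * e3 - lam * ω ^ (-ρ1).val * Q ρ1 (ρ2 - 1) * e4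
end
end
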